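/- arXiv:2403.12716 — 6 statements merged into one kernel-verified Lean document; each statement's English description precedes it below -/
import Mathlib

section
/- Let R be an integral domain, n ≥ 1 a natural number, f and g nonzero multivariate polynomials in MvPolynomial (Fin n) R, and D : ℕ a natural number such that degreeOf i (f * g) < D for every i : Fin n. Then natDegree (φ_D f * φ_D g) ≥ degreeOf (n−1) (f * g) * D^(n−1), where n−1 denotes the last index of Fin n. -/
open MvPolynomial Polynomial

/-- Standard Kronecker substitution: sends `X i` to `x ^ (D ^ i)`. -/
noncomputable def kroneckerSubst (R : Type*) [CommRing R] (n D : ℕ) :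
    MvPolynomial (Fin n) R →ₐ[R] Polynomial R :=
  MvPolynomial.aeval (fun i : Fin n => (Polynomial.X : Polynomial R) ^ (D ^ (i : ℕ)))

/-- Base-`D` expansions of fixed length with digits below `D` are unique. -/
theorem digit_sum_injective {n D : ℕ} {a b : Fin n → ℕ} (ha : ∀ i, a i < D) (hb : ∀ i, b i < D)
    (h : ∑ i, a i * D ^ (i : ℕ) = ∑ i, b i * D ^ (i : ℕ)) : a = b := by
  have key : (fun i => (⟨a i, ha i⟩ : Fin D)) = fun i => ⟨b i, hb i⟩ := by
    apply finFunctionFinEquiv.injective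
    apply Fin.ext
    simpa only [finFunctionFinEquiv_apply] using h
  funext i
  exact congrArg Fin.val (congrFun key i)

theorem kroneckerSubst_eq_sum {R : Type*} [CommRing R] {n : ℕ} (D : ℕ)
    (p : MvPolynomial (Fin n) R) :
    kroneckerSubst R n D p =
      ∑ m ∈ p.support, Polynomial.monomial (∑ i, m i * D ^ (i : ℕ)) (p.coeff m) := by
  rw [kroneckerSubst, MvPolynomial.aeval_def, MvPolynomial.eval₂_eq']
  refine Finset.sum_congr rfl fun m _ => ?_
  rw [← Polynomial.C_mul_X_pow_eq_monomial, ← Finset.prod_pow_eq_pow_sum]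
  simp only [← pow_mul, mul_comm, Polynomial.algebraMap_eq]

/-- The Kronecker substitution preserves coefficients when `D` exceeds all partial degrees. -/
theorem coeff_kroneckerSubst {R : Type*} [CommRing R] {n D : ℕ} {p : MvPolynomial (Fin n) R}
    (hD : ∀ i, p.degreeOf i < D) {m : Fin n →₀ ℕ} (hm : m ∈ p.support) :
    (kroneckerSubst R n D p).coeff (∑ i, m i * D ^ (i : ℕ)) = p.coeff m := by
  have digit_lt {k : Fin n →₀ ℕ} (hk : k ∈ p.support) (i : Fin n) : k i < D :=
    (MvPolynomial.monomial_le_degreeOf i hk).trans_lt (hD i)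
  rw [kroneckerSubst_eq_sum, Polynomial.finsetSum_coeff, Finset.sum_eq_single_of_mem m hm]
  · exact Polynomial.coeff_monomial_same _ _
  · intro k hk hkm
    refine Polynomial.coeff_monomial_of_ne _ fun h => hkm ?_
    exact DFunLike.coe_injective (digit_sum_injective (digit_lt hk) (digit_lt hm) (by simp [h]))

theorem degreeOf_mul_pow_le_natDegree_kroneckerSubst {R : Type*} [CommRing R] {n D : ℕ}
    {p : MvPolynomial (Fin n) R} (hp : p ≠ 0) (hD : ∀ i, p.degreeOf i < D) (i : Fin n) :
    p.degreeOf i * D ^ (i : ℕ) ≤ (kroneckerSubst R n D p).natDegree := by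
  obtain ⟨m, hm, hmi⟩ := Finset.exists_mem_eq_sup p.support
    (MvPolynomial.support_nonempty.mpr hp) (fun m => m i)
  rw [MvPolynomial.degreeOf_eq_sup, hmi]
  calc m i * D ^ (i : ℕ) ≤ ∑ j, m j * D ^ (j : ℕ) :=
        Finset.single_le_sum (f := fun j => m j * D ^ (j : ℕ)) (fun _ _ => Nat.zero_le _)
          (Finset.mem_univ i)
    _ ≤ (kroneckerSubst R n D p).natDegree := Polynomial.le_natDegree_of_ne_zero <| by
        rw [coeff_kroneckerSubst hD hm]
        exact MvPolynomial.mem_support_iff.mp hm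

theorem stmt_0 {R : Type*} [CommRing R] [IsDomain R] {n : ℕ} (hn : 1 ≤ n)
    (f g : MvPolynomial (Fin n) R) (hf : f ≠ 0) (hg : g ≠ 0) (D : ℕ)
    (hD : ∀ i : Fin n, (f * g).degreeOf i < D) :
    (f * g).degreeOf ⟨n - 1, by omega⟩ * D ^ (n - 1) ≤
      (kroneckerSubst R n D f * kroneckerSubst R n D g).natDegree := by
  rw [← map_mul]
  exact degreeOf_mul_pow_le_natDegree_kroneckerSubst (mul_ne_zero hf hg) hD ⟨n - 1, by omega⟩
end

section
/- Let R be a commutative ring, n : ℕ, f and g multivariate polynomials in MvPolynomial (Fin n) R, and D : ℕ a natural number such that degreeOf i f + degreeOf i g < D for every i : Fin n. Then natDegree (φ_D f * φ_D g) ≤ D^n − 1. -/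
open MvPolynomial Polynomial

theorem natDegree_kroneckerSubst_le {R : Type*} [CommRing R] (n D : ℕ)
    (f : MvPolynomial (Fin n) R) :
    (kroneckerSubst R n D f).natDegree ≤ ∑ i : Fin n, f.degreeOf i * D ^ (i : ℕ) := by
  rw [kroneckerSubst, MvPolynomial.aeval_def, MvPolynomial.eval₂_eq']
  refine Polynomial.natDegree_sum_le_of_forall_le _ _ fun m hm => ?_
  rw [Polynomial.algebraMap_eq]
  refine (Polynomial.natDegree_C_mul_le _ _).trans ((Polynomial.natDegree_prod_le _ _).trans ?_)
  refine Finset.sum_le_sum fun i _ => ?_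
  rw [← pow_mul]
  refine (Polynomial.natDegree_X_pow_le _).trans ?_
  rw [mul_comm]
  exact Nat.mul_le_mul_right _ (MvPolynomial.monomial_le_degreeOf i hm)

theorem sum_mul_pow_le_pow_sub_one {n D : ℕ} (a : Fin n → ℕ) (ha : ∀ i, a i < D) :
    ∑ i : Fin n, a i * D ^ (i : ℕ) ≤ D ^ n - 1 := by
  rcases Nat.eq_zero_or_pos n with rfl | hn
  · simp
  have hD : 1 ≤ D := Nat.one_le_of_lt (ha ⟨0, hn⟩)
  calc ∑ i : Fin n, a i * D ^ (i : ℕ)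
      ≤ ∑ i : Fin n, (D - 1) * D ^ (i : ℕ) :=
        Finset.sum_le_sum fun i _ => Nat.mul_le_mul_right _ (Nat.le_sub_one_of_lt (ha i))
    _ = D ^ n - 1 := by
        rw [← Finset.mul_sum, Fin.sum_univ_eq_sum_range (fun i => D ^ i) n, mul_comm,
          geom_sum_mul_of_one_le hD]

theorem stmt_1 {R : Type*} [CommRing R] (n D : ℕ)
    (f g : MvPolynomial (Fin n) R)
    (hD : ∀ i : Fin n, f.degreeOf i + g.degreeOf i < D) :
    (kroneckerSubst R n D f * kroneckerSubst R n D g).natDegree ≤ D ^ n - 1 := by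
  refine Polynomial.natDegree_mul_le.trans ((add_le_add (natDegree_kroneckerSubst_le n D f)
    (natDegree_kroneckerSubst_le n D g)).trans ?_)
  rw [← Finset.sum_add_distrib]
  simp_rw [← add_mul]
  exact sum_mul_pow_le_pow_sub_one _ hD
end

section
/- Let R be a commutative ring, n : ℕ, h : MvPolynomial (Fin n) R, and i, j : Fin n with i ≠ j. Set D = degreeOf j h + 1 and let ψ = ψ_{i→j,D}. Then D * degreeOf i h ≤ degreeOf j (ψ h) ≤ D * degreeOf i h + degreeOf j h. -/
open MvPolynomial

/-- Single Kronecker substitution: sends `X i` to `(X j) ^ D` and fixes every other variable. -/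
noncomputable def singleKron (R : Type*) [CommRing R] {n : ℕ} (i j : Fin n) (D : ℕ) :
    MvPolynomial (Fin n) R →ₐ[R] MvPolynomial (Fin n) R :=
  MvPolynomial.aeval (fun m : Fin n =>
    if m = i then (MvPolynomial.X j : MvPolynomial (Fin n) R) ^ D else MvPolynomial.X m)

/-- The exponent vector of the image of the monomial `X ^ s` under `singleKron R i j D`. -/
noncomputable def kronExponent {n : ℕ} (i j : Fin n) (D : ℕ) (s : Fin n →₀ ℕ) : Fin n →₀ ℕ :=
  s.erase i + Finsupp.single j (D * s i)

theorem kronExponent_apply_target {n : ℕ} {i j : Fin n} (hij : i ≠ j) (D : ℕ)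
    (s : Fin n →₀ ℕ) : kronExponent i j D s j = s j + D * s i := by
  simp [kronExponent, Finsupp.erase_ne hij.symm]

theorem kronExponent_apply_of_ne {n : ℕ} {i j k : Fin n} (hki : k ≠ i) (hkj : k ≠ j) (D : ℕ)
    (s : Fin n →₀ ℕ) : kronExponent i j D s k = s k := by
  simp [kronExponent, Finsupp.erase_ne hki, Finsupp.single_eq_of_ne hkj]

/-- Exponent vectors are recovered from their images, by division with remainder, as long as
the exponent of `X j` is smaller than `D`. -/
theorem kronExponent_injOn {n : ℕ} {i j : Fin n} (hij : i ≠ j) (D : ℕ) :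
    Set.InjOn (kronExponent i j D) {s | s j < D} := by
  intro s hs t ht hst
  have hs : s j < D := hs
  have ht : t j < D := ht
  have key : s j + D * s i = t j + D * t i := by
    simpa only [kronExponent_apply_target hij] using DFunLike.congr_fun hst j
  have hj : s j = t j := by
    simpa [Nat.mod_eq_of_lt hs, Nat.mod_eq_of_lt ht] using congrArg (· % D) key
  have hi : s i = t i := by
    have hD : 0 < D := by lia
    rw [hj] at key
    exact Nat.eq_of_mul_eq_mul_left hD (Nat.add_left_cancel key)
  ext k
  by_cases hki : k = i
  · rw [hki, hi]
  by_cases hkj : k = j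
  · rw [hkj, hj]
  simpa only [kronExponent_apply_of_ne hki hkj] using DFunLike.congr_fun hst k

theorem singleKron_monomial {R : Type*} [CommRing R] {n : ℕ} (i j : Fin n) (D : ℕ)
    (s : Fin n →₀ ℕ) (a : R) :
    singleKron R i j D (monomial s a) = monomial (kronExponent i j D s) a := by
  have hrest : ∏ m ∈ Finset.univ.erase i,
      (if m = i then (X j : MvPolynomial (Fin n) R) ^ D else X m) ^ s m =
        ∏ m ∈ Finset.univ.erase i, X m ^ (s.erase i) m :=
    Finset.prod_congr rfl fun m hm => by
      rw [if_neg (Finset.ne_of_mem_erase hm), Finsupp.erase_ne (Finset.ne_of_mem_erase hm)]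
  have hmonomial : monomial (s.erase i) a =
      C a * ∏ m ∈ Finset.univ.erase i, (X m : MvPolynomial (Fin n) R) ^ (s.erase i) m := by
    rw [monomial_eq, Finsupp.prod_fintype _ _ fun _ => pow_zero _,
      ← Finset.mul_prod_erase _ _ (Finset.mem_univ i), Finsupp.erase_same, pow_zero, one_mul]
  rw [singleKron, aeval_monomial, Finsupp.prod_fintype _ _ fun _ => pow_zero _,
    ← Finset.mul_prod_erase _ _ (Finset.mem_univ i), hrest, if_pos rfl, ← pow_mul,
    kronExponent, monomial_add_single, hmonomial, algebraMap_eq]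
  ring

theorem singleKron_eq_sum {R : Type*} [CommRing R] {n : ℕ} (i j : Fin n) (D : ℕ)
    (h : MvPolynomial (Fin n) R) :
    singleKron R i j D h = ∑ s ∈ h.support, monomial (kronExponent i j D s) (h.coeff s) := by
  conv_lhs => rw [h.as_sum]
  simp only [map_sum, singleKron_monomial]

theorem coeff_kronExponent_singleKron {R : Type*} [CommRing R] {n : ℕ} {i j : Fin n}
    (hij : i ≠ j) {D : ℕ} {h : MvPolynomial (Fin n) R} (hD : h.degreeOf j < D)
    {s : Fin n →₀ ℕ} (hs : s ∈ h.support) :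
    (singleKron R i j D h).coeff (kronExponent i j D s) = h.coeff s := by
  have hlt : ∀ t ∈ h.support, t j < D := fun t ht => (monomial_le_degreeOf j ht).trans_lt hD
  rw [singleKron_eq_sum, coeff_sum, Finset.sum_eq_single_of_mem s hs, coeff_monomial, if_pos rfl]
  intro t ht hts
  rw [coeff_monomial, if_neg]
  exact fun heq => hts (kronExponent_injOn hij D (hlt t ht) (hlt s hs) heq)

theorem mul_degreeOf_le_degreeOf_singleKron {R : Type*} [CommRing R] {n : ℕ} {i j : Fin n}
    (hij : i ≠ j) {D : ℕ} {h : MvPolynomial (Fin n) R} (hD : h.degreeOf j < D) :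
    D * h.degreeOf i ≤ (singleKron R i j D h).degreeOf j := by
  rcases eq_or_ne h 0 with rfl | hne
  · simp
  obtain ⟨s, hs, hsi⟩ := Finset.exists_mem_eq_sup h.support (support_nonempty.mpr hne) fun s => s i
  rw [← degreeOf_eq_sup] at hsi
  have hmem : kronExponent i j D s ∈ (singleKron R i j D h).support := by
    rw [mem_support_iff, coeff_kronExponent_singleKron hij hD hs]
    exact mem_support_iff.mp hs
  have hle := monomial_le_degreeOf j hmem
  rw [kronExponent_apply_target hij] at hle
  rw [hsi]
  exact (Nat.le_add_left _ _).trans hle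

theorem degreeOf_singleKron_le {R : Type*} [CommRing R] {n : ℕ} {i j : Fin n}
    (hij : i ≠ j) (D : ℕ) (h : MvPolynomial (Fin n) R) :
    (singleKron R i j D h).degreeOf j ≤ D * h.degreeOf i + h.degreeOf j := by
  rw [singleKron_eq_sum]
  refine (degreeOf_sum_le _ _ _).trans (Finset.sup_le fun s hs => ?_)
  rw [degreeOf_monomial_eq _ _ (mem_support_iff.mp hs), kronExponent_apply_target hij, add_comm]
  gcongr
  · exact monomial_le_degreeOf i hs
  · exact monomial_le_degreeOf j hs

theorem stmt_6 {R : Type*} [CommRing R] {n : ℕ} (h : MvPolynomial (Fin n) R)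
    (i j : Fin n) (hij : i ≠ j) :
    (h.degreeOf j + 1) * h.degreeOf i ≤
        (singleKron R i j (h.degreeOf j + 1) h).degreeOf j ∧
      (singleKron R i j (h.degreeOf j + 1) h).degreeOf j ≤
        (h.degreeOf j + 1) * h.degreeOf i + h.degreeOf j :=
  ⟨mul_degreeOf_le_degreeOf_singleKron hij (Nat.lt_succ_self _), degreeOf_singleKron_le hij _ h⟩
end

section
/- Let p₁ ≥ 2 be a natural number and p₂ = p₁ − 1. Let k₁, k₂ be natural numbers with k₁ ≤ k₂, k₁ < p₁ and k₂ < p₂. Then K = p₁ * (k₂ − k₁) + k₁ satisfies K % p₁ = k₁, K % p₂ = k₂, and K < p₁ * p₂. -/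
theorem stmt_12 (p₁ : ℕ) (hp : 2 ≤ p₁) (k₁ k₂ : ℕ) (hk : k₁ ≤ k₂)
    (h₁ : k₁ < p₁) (h₂ : k₂ < p₁ - 1) :
    (p₁ * (k₂ - k₁) + k₁) % p₁ = k₁ ∧
      (p₁ * (k₂ - k₁) + k₁) % (p₁ - 1) = k₂ ∧
      p₁ * (k₂ - k₁) + k₁ < p₁ * (p₁ - 1) := by
  obtain ⟨d, rfl⟩ := Nat.exists_eq_add_of_le hk
  obtain ⟨q, rfl⟩ := Nat.exists_eq_add_of_le' (one_le_two.trans hp)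
  rw [Nat.add_sub_cancel] at h₂
  rw [Nat.add_sub_cancel_left, Nat.add_sub_cancel]
  refine ⟨by rw [Nat.mul_add_mod, Nat.mod_eq_of_lt h₁], ?_, ?_⟩
  · rw [show (q + 1) * d + k₁ = q * d + (k₁ + d) by ring, Nat.mul_add_mod, Nat.mod_eq_of_lt h₂]
  · calc (q + 1) * d + k₁ < (q + 1) * d + (q + 1) := by gcongr
      _ = (q + 1) * (d + 1) := by ring
      _ ≤ (q + 1) * q := by gcongr; omega
end

section
/- Let R be a commutative ring, n : ℕ, and f, g : MvPolynomial (Fin n) R. Let p : Fin n → ℕ be pairwise coprime (Nat.Coprime (p i) (p j) for all i ≠ j) with degreeOf i f + degreeOf i g < p i for every i, and set M = ∏_{i} p i. Let U : (Fin n →₀ ℕ) → ℕ be a function satisfying, for every exponent vector v and every i : Fin n, U v % p i = v i % p i and U v < M. For a multivariate polynomial q define its CRT reduction as the univariate polynomial reduce q = ∑_{v ∈ support q} C (coeff v q) * x^(U v). Then for every exponent vector v : Fin n →₀ ℕ with v i < p i for all i, the coefficient of f * g at v equals (coefficient of (reduce f) * (reduce g) at U v) + (coefficient of (reduce f) * (reduce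 g) at U v + M). -/
open MvPolynomial Polynomial

/-- CRT reduction of a multivariate polynomial to a univariate polynomial along
an exponent-encoding function `U`. -/
noncomputable def crtReduce {R : Type*} [CommRing R] {n : ℕ}
    (U : (Fin n →₀ ℕ) → ℕ) (q : MvPolynomial (Fin n) R) : Polynomial R :=
  ∑ v ∈ q.support, Polynomial.C (q.coeff v) * Polynomial.X ^ (U v)

theorem Nat.modEq_fintype_prod_of_pairwise_coprime {ι : Type*} [Fintype ι] {p : ι → ℕ}
    (hp : Pairwise fun i j => Nat.Coprime (p i) (p j)) {a b : ℕ}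
    (h : ∀ i, a ≡ b [MOD p i]) : a ≡ b [MOD ∏ i, p i] := by
  rw [Nat.modEq_iff_dvd]
  push_cast
  exact Fintype.prod_dvd_of_coprime (fun i j hij => Nat.isCoprime_iff_coprime.2 (hp hij))
    fun i => Nat.modEq_iff_dvd.1 (h i)

theorem MvPolynomial.coeff_mul_eq_sum_support {R σ : Type*} [CommRing R] [DecidableEq σ]
    (f g : MvPolynomial σ R) (v : σ →₀ ℕ) :
    (f * g).coeff v = ∑ a ∈ f.support, ∑ b ∈ g.support,
      if a + b = v then f.coeff a * g.coeff b else 0 := by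
  conv_lhs => rw [f.as_sum, g.as_sum]
  simp only [Finset.sum_mul_sum, MvPolynomial.coeff_sum, MvPolynomial.monomial_mul,
    MvPolynomial.coeff_monomial]

theorem crtReduce_mul_coeff {R : Type*} [CommRing R] {n : ℕ} (U : (Fin n →₀ ℕ) → ℕ)
    (f g : MvPolynomial (Fin n) R) (k : ℕ) :
    (crtReduce U f * crtReduce U g).coeff k = ∑ a ∈ f.support, ∑ b ∈ g.support,
      if U a + U b = k then f.coeff a * g.coeff b else 0 := by
  simp only [crtReduce, Finset.sum_mul_sum, Polynomial.finsetSum_coeff,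
    Polynomial.C_mul_X_pow_eq_monomial, Polynomial.monomial_mul_monomial,
    Polynomial.coeff_monomial]

theorem stmt_13 {R : Type*} [CommRing R] {n : ℕ}
    (f g : MvPolynomial (Fin n) R) (p : Fin n → ℕ)
    (hcop : ∀ i j : Fin n, i ≠ j → Nat.Coprime (p i) (p j))
    (hdeg : ∀ i : Fin n, f.degreeOf i + g.degreeOf i < p i)
    (U : (Fin n →₀ ℕ) → ℕ)
    (hU1 : ∀ (v : Fin n →₀ ℕ) (i : Fin n), U v % p i = v i % p i)
    (hU2 : ∀ v : Fin n →₀ ℕ, U v < ∏ i : Fin n, p i)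
    (v : Fin n →₀ ℕ) (hv : ∀ i : Fin n, v i < p i) :
    (f * g).coeff v =
      (crtReduce U f * crtReduce U g).coeff (U v) +
        (crtReduce U f * crtReduce U g).coeff (U v + ∏ i : Fin n, p i) := by
  rw [MvPolynomial.coeff_mul_eq_sum_support, crtReduce_mul_coeff, crtReduce_mul_coeff,
    ← Finset.sum_add_distrib]
  refine Finset.sum_congr rfl fun a ha => ?_
  rw [← Finset.sum_add_distrib]
  refine Finset.sum_congr rfl fun b hb => ?_
  have hsum : ∀ i, U a + U b ≡ a i + b i [MOD p i] := fun i =>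
    Nat.ModEq.add (hU1 a i) (hU1 b i)
  have hlt : ∀ i, a i + b i < p i := fun i =>
    (add_le_add (MvPolynomial.monomial_le_degreeOf i ha)
      (MvPolynomial.monomial_le_degreeOf i hb)).trans_lt (hdeg i)
  have ha2 := hU2 a
  have hb2 := hU2 b
  have hv2 := hU2 v
  have key : a + b = v ↔ U a + U b = U v ∨ U a + U b = U v + ∏ i, p i := by
    constructor
    · rintro rfl
      have hmod : U a + U b ≡ U (a + b) [MOD ∏ i, p i] :=
        Nat.modEq_fintype_prod_of_pairwise_coprime (fun i j hij => hcop i j hij) fun i =>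
          (hsum i).trans (hU1 (a + b) i).symm
      rw [Nat.ModEq, Nat.mod_eq_of_lt hv2] at hmod
      rcases lt_or_ge (U a + U b) (∏ i, p i) with h | h
      · rw [Nat.mod_eq_of_lt h] at hmod
        exact Or.inl hmod
      · rw [Nat.mod_eq_sub_mod h, Nat.mod_eq_of_lt (by omega)] at hmod
        right
        omega
    · intro h
      ext i
      have hmod : U a + U b ≡ U v [MOD p i] := by
        rcases h with h | h
        · rw [h]
        · rw [h]
          have hdvd : p i ∣ ∏ i, p i := Finset.dvd_prod_of_mem p (Finset.mem_univ i)
          simpa using (Nat.ModEq.refl (U v)).add ((Nat.modEq_zero_iff_dvd).2 hdvd)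
      exact Nat.ModEq.eq_of_lt_of_lt ((hsum i).symm.trans (hmod.trans (hU1 v i))) (hlt i) (hv i)
  by_cases h1 : U a + U b = U v
  · have h2 : U a + U b ≠ U v + ∏ i, p i := by omega
    rw [if_pos (key.2 (Or.inl h1)), if_pos h1, if_neg h2, add_zero]
  · simp only [key, h1, false_or, if_false, zero_add]
end

section
/- Let R be a commutative ring, n : ℕ, and f, g : MvPolynomial (Fin n) R. Let p : Fin n → ℕ be pairwise coprime with degreeOf i f + degreeOf i g < p i for every i, set M = ∏_{i} p i, and let U : (Fin n →₀ ℕ) → ℕ satisfy U v % p i = v i % p i and U v < M for every v and i. Define reduce q = ∑_{v ∈ support q} C (coeff v q) * x^(U v). Then natDegree ((reduce f) * (reduce g)) ≤ 2 * M − 2; in particular the degree of the univariate product obtained from CRT reduction is less than 2M. -/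
open MvPolynomial Polynomial

theorem natDegree_crtReduce_le {R : Type*} [CommRing R] {n : ℕ} {U : (Fin n →₀ ℕ) → ℕ} {d : ℕ}
    (hU : ∀ v, U v ≤ d) (q : MvPolynomial (Fin n) R) : (crtReduce U q).natDegree ≤ d :=
  Polynomial.natDegree_sum_le_of_forall_le _ _ fun v _ =>
    (Polynomial.natDegree_C_mul_X_pow_le _ _).trans (hU v)

theorem stmt_14 {R : Type*} [CommRing R] {n : ℕ}
    (f g : MvPolynomial (Fin n) R) (p : Fin n → ℕ)
    (hcop : ∀ i j : Fin n, i ≠ j → Nat.Coprime (p i) (p j))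
    (hdeg : ∀ i : Fin n, f.degreeOf i + g.degreeOf i < p i)
    (U : (Fin n →₀ ℕ) → ℕ)
    (hU1 : ∀ (v : Fin n →₀ ℕ) (i : Fin n), U v % p i = v i % p i)
    (hU2 : ∀ v : Fin n →₀ ℕ, U v < ∏ i : Fin n, p i) :
    (crtReduce U f * crtReduce U g).natDegree ≤ 2 * (∏ i : Fin n, p i) - 2 := by
  have hU (v : Fin n →₀ ℕ) : U v ≤ (∏ i : Fin n, p i) - 1 := Nat.le_sub_one_of_lt (hU2 v)
  have hf := natDegree_crtReduce_le hU f
  have hg := natDegree_crtReduce_le hU g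
  exact Polynomial.natDegree_mul_le.trans (by omega)
end
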